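/- arXiv:1907.07920 — 4 statements merged into one kernel-verified Lean document; each statement's English description precedes it below -/
import Mathlib

section
/- Let m ≥ 2 be an integer and r > 0. Let w : [0,r] → ℝ be of class C² with w(0) = 0 and w(t) > 0 for all t ∈ (0,r]; let f : [0,r] → ℝ be of class C²; let θ : [0,r] → ℝ be of class C¹ and non-decreasing; and let Ric : [0,r] → ℝ be continuous. Assume: (i) Ric(t) − f''(t) ≥ −(m−1)·w''(t)/w(t) for all t ∈ (0,r], and (ii) f'(t)·w'(t) ≤ θ(t)·w'(t) for all t ∈ [0,r]. Then (1/w(r)²)·∫_0^r ((m−1)·w'(t)² − Ric(t)·w(t)²) dt + f'(r) ≤ (m−1)·w'(r)/w(r) + θ(r). -/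
/-- Analytic core of the weighted Laplacian comparison under a lower bound on the
`∞`-Bakry-Émery Ricci curvature (Theorem 3.1(b) of Hurtado–Palmer–Rosales): if
`Ric(t) - f''(t) ≥ -(m-1) w''(t)/w(t)` on `(0,r]` and `f'(t) w'(t) ≤ θ(t) w'(t)` on `[0,r]`
with `θ` C¹ and non-decreasing, then
`(1/w(r)²) ∫_0^r ((m-1) w'(t)² - Ric(t) w(t)²) dt + f'(r) ≤ (m-1) w'(r)/w(r) + θ(r)`. -/
theorem stmt_6 (m : ℕ) (hm : 2 ≤ m) (r : ℝ) (hr : 0 < r)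
    (w w' w'' f f' f'' θ θ' Ric : ℝ → ℝ)
    (hw' : ∀ t ∈ Set.Icc 0 r, HasDerivWithinAt w (w' t) (Set.Icc 0 r) t)
    (hw'' : ∀ t ∈ Set.Icc 0 r, HasDerivWithinAt w' (w'' t) (Set.Icc 0 r) t)
    (hw''c : ContinuousOn w'' (Set.Icc 0 r))
    (hw0 : w 0 = 0) (hwpos : ∀ t ∈ Set.Ioc 0 r, 0 < w t)
    (hf' : ∀ t ∈ Set.Icc 0 r, HasDerivWithinAt f (f' t) (Set.Icc 0 r) t)
    (hf'' : ∀ t ∈ Set.Icc 0 r, HasDerivWithinAt f' (f'' t) (Set.Icc 0 r) t)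
    (hf''c : ContinuousOn f'' (Set.Icc 0 r))
    (hθ' : ∀ t ∈ Set.Icc 0 r, HasDerivWithinAt θ (θ' t) (Set.Icc 0 r) t)
    (hθ'c : ContinuousOn θ' (Set.Icc 0 r))
    (hθmono : MonotoneOn θ (Set.Icc 0 r))
    (hRic : ContinuousOn Ric (Set.Icc 0 r))
    (hi : ∀ t ∈ Set.Ioc 0 r, Ric t - f'' t ≥ -((m : ℝ) - 1) * w'' t / w t)
    (hii : ∀ t ∈ Set.Icc 0 r, f' t * w' t ≤ θ t * w' t) :
    (1 / (w r) ^ 2) *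
        (∫ t in (0 : ℝ)..r, (((m : ℝ) - 1) * (w' t) ^ 2 - Ric t * (w t) ^ 2)) +
      f' r ≤ ((m : ℝ) - 1) * w' r / w r + θ r := by
  have hwr : 0 < w r := hwpos r ⟨hr, le_rfl⟩
  have hG : ∀ t ∈ Set.Icc 0 r, HasDerivWithinAt
      (fun s => ((m : ℝ) - 1) * (w s * w' s) + (θ s - f' s) * (w s) ^ 2)
      (((m : ℝ) - 1) * (w' t * w' t + w t * w'' t) +
        ((θ' t - f'' t) * (w t) ^ 2 + (θ t - f' t) * (2 * w t * w' t))) (Set.Icc 0 r) t := by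
    intro t ht
    have hsq : HasDerivWithinAt (fun s => (w s) ^ 2) (2 * w t * w' t) (Set.Icc 0 r) t := by
      simpa using (hw' t ht).fun_pow 2
    exact (((hw' t ht).fun_mul (hw'' t ht)).const_mul _).fun_add
      (((hθ' t ht).fun_sub (hf'' t ht)).fun_mul hsq)
  have hint : MeasureTheory.IntegrableOn
      (fun t => ((m : ℝ) - 1) * (w' t) ^ 2 - Ric t * (w t) ^ 2) (Set.Icc 0 r) := by
    have hwc : ContinuousOn w (Set.Icc 0 r) := fun t ht => (hw' t ht).continuousWithinAt
    have hw'c : ContinuousOn w' (Set.Icc 0 r) := fun t ht => (hw'' t ht).continuousWithinAt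
    exact ((continuousOn_const.mul (hw'c.pow 2)).sub (hRic.mul (hwc.pow 2))).integrableOn_Icc
  have hbound : ∀ t ∈ Set.Ioo 0 r, ((m : ℝ) - 1) * (w' t) ^ 2 - Ric t * (w t) ^ 2 ≤
      ((m : ℝ) - 1) * (w' t * w' t + w t * w'' t) +
        ((θ' t - f'' t) * (w t) ^ 2 + (θ t - f' t) * (2 * w t * w' t)) := by
    intro t ht
    have htc := Set.Ioo_subset_Icc_self ht
    have hwt : 0 < w t := hwpos t ⟨ht.1, ht.2.le⟩
    have hθ'0 : 0 ≤ θ' t := by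
      rw [← (hθ' t htc).derivWithin (uniqueDiffOn_Icc hr t htc)]
      exact hθmono.derivWithin_nonneg
    have hric := hi t ⟨ht.1, ht.2.le⟩
    rw [ge_iff_le, div_le_iff₀ hwt] at hric
    have h₁ := mul_le_mul_of_nonneg_right hric hwt.le
    have h₂ := mul_nonneg hθ'0 (sq_nonneg (w t))
    have h₃ := mul_le_mul_of_nonneg_left (hii t htc) hwt.le
    nlinarith
  have hle := intervalIntegral.integral_le_sub_of_hasDeriv_right_of_le hr.le
    (fun t ht => (hG t ht).continuousWithinAt)
    (fun t ht => ((hG t (Set.Ioo_subset_Icc_self ht)).hasDerivAt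
      (Icc_mem_nhds ht.1 ht.2)).hasDerivWithinAt) hint hbound
  simp only [hw0, zero_mul, mul_zero, ne_eq, OfNat.ofNat_ne_zero, not_false_eq_true, zero_pow,
    add_zero, sub_zero] at hle
  calc _ ≤ 1 / (w r) ^ 2 * (((m : ℝ) - 1) * (w r * w' r) + (θ r - f' r) * (w r) ^ 2) + f' r := by
        gcongr
    _ = _ := by
        field_simp
        ring
end

section
/- Let m ≥ 2 be an integer, q > 0 a real number, and r > 0. Let w : [0,r] → ℝ be of class C² with w(0) = 0 and w(t) > 0 for all t ∈ (0,r]; let f : [0,r] → ℝ be of class C²; and let S : [0,r] → ℝ be continuous. Assume S(t) − f''(t)/(m−1) − f'(t)²/((m−1)q) ≥ −((m+q−1)/(m−1))·w''(t)/w(t) for all t ∈ (0,r]. Then (1/w(r)²)·∫_0^r (w'(t)² − S(t)·w(t)²) dt + f'(r)/(m−1) ≤ ((m+q−1)/(m−1))·w'(r)/w(r). -/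
/-- Analytic core of the Hessian comparison under a lower bound on the `q`-weighted
sectional curvature (Theorem 3.2(a) of Hurtado–Palmer–Rosales): if
`S(t) - f''(t)/(m-1) - f'(t)²/((m-1)q) ≥ -((m+q-1)/(m-1)) w''(t)/w(t)` on `(0,r]`, then
`(1/w(r)²) ∫_0^r (w'(t)² - S(t) w(t)²) dt + f'(r)/(m-1) ≤ ((m+q-1)/(m-1)) w'(r)/w(r)`. -/
theorem stmt_7 (m : ℕ) (hm : 2 ≤ m) (q : ℝ) (hq : 0 < q) (r : ℝ) (hr : 0 < r)
    (w w' w'' f f' f'' S : ℝ → ℝ)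
    (hw' : ∀ t ∈ Set.Icc 0 r, HasDerivWithinAt w (w' t) (Set.Icc 0 r) t)
    (hw'' : ∀ t ∈ Set.Icc 0 r, HasDerivWithinAt w' (w'' t) (Set.Icc 0 r) t)
    (hw''c : ContinuousOn w'' (Set.Icc 0 r))
    (hw0 : w 0 = 0) (hwpos : ∀ t ∈ Set.Ioc 0 r, 0 < w t)
    (hf' : ∀ t ∈ Set.Icc 0 r, HasDerivWithinAt f (f' t) (Set.Icc 0 r) t)
    (hf'' : ∀ t ∈ Set.Icc 0 r, HasDerivWithinAt f' (f'' t) (Set.Icc 0 r) t)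
    (hf''c : ContinuousOn f'' (Set.Icc 0 r))
    (hS : ContinuousOn S (Set.Icc 0 r))
    (hi : ∀ t ∈ Set.Ioc 0 r,
      S t - f'' t / ((m : ℝ) - 1) - (f' t) ^ 2 / (((m : ℝ) - 1) * q) ≥
        -(((m : ℝ) + q - 1) / ((m : ℝ) - 1)) * w'' t / w t) :
    (1 / (w r) ^ 2) * (∫ t in (0 : ℝ)..r, ((w' t) ^ 2 - S t * (w t) ^ 2)) +
      f' r / ((m : ℝ) - 1) ≤
        (((m : ℝ) + q - 1) / ((m : ℝ) - 1)) * w' r / w r := by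
  have hn : (0 : ℝ) < (m : ℝ) - 1 := by
    have : (2 : ℝ) ≤ m := by exact_mod_cast hm
    linarith
  rw [show (m : ℝ) + q - 1 = ((m : ℝ) - 1) + q by ring] at hi ⊢
  generalize (m : ℝ) - 1 = n at hn hi ⊢
  have hwr : 0 < w r := hwpos r ⟨hr, le_rfl⟩
  have hwc : ContinuousOn w (Set.Icc 0 r) := fun t ht => (hw' t ht).continuousWithinAt
  have hw'c : ContinuousOn w' (Set.Icc 0 r) := fun t ht => (hw'' t ht).continuousWithinAt
  have hG : ∀ t ∈ Set.Icc 0 r,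
      HasDerivWithinAt (fun t => (n + q) / n * (w t * w' t) - w t ^ 2 * f' t / n)
        ((n + q) / n * (w' t * w' t + w t * w'' t)
          - (2 * w t * w' t * f' t + w t ^ 2 * f'' t) / n) (Set.Icc 0 r) t := by
    intro t ht
    have h := (((hw' t ht).mul (hw'' t ht)).const_mul ((n + q) / n)).sub
      ((((hw' t ht).pow 2).mul (hf'' t ht)).div_const n)
    refine h.congr_deriv ?_
    simp
  have key : ∫ t in (0 : ℝ)..r, ((w' t) ^ 2 - S t * (w t) ^ 2) ≤
      ((n + q) / n * (w r * w' r) - w r ^ 2 * f' r / n)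
        - ((n + q) / n * (w 0 * w' 0) - w 0 ^ 2 * f' 0 / n) := by
    refine intervalIntegral.integral_le_sub_of_hasDeriv_right_of_le hr.le
      (fun t ht => (hG t ht).continuousWithinAt)
      (fun t ht => ((hG t (Set.Ioo_subset_Icc_self ht)).hasDerivAt
        (Icc_mem_nhds ht.1 ht.2)).hasDerivWithinAt)
      (((hw'c.pow 2).sub (hS.mul (hwc.pow 2))).integrableOn_Icc) ?_
    intro t ht
    have hwt : 0 < w t := hwpos t ⟨ht.1, ht.2.le⟩
    have hmul := mul_le_mul_of_nonneg_right (hi t ⟨ht.1, ht.2.le⟩) (sq_nonneg (w t))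
    have hcancel : -((n + q) / n) * w'' t / w t * w t ^ 2 = -((n + q) / n) * (w t * w'' t) := by
      field_simp
    have hsq : 0 ≤ (q * w' t - w t * f' t) ^ 2 / (n * q) := by positivity
    have hexpand : (q * w' t - w t * f' t) ^ 2 / (n * q) =
        (n + q) / n * (w' t * w' t) - w' t ^ 2 - 2 * w t * w' t * f' t / n
          + f' t ^ 2 / (n * q) * w t ^ 2 := by
      field_simp
      ring
    rw [hcancel] at hmul
    rw [hexpand] at hsq
    linear_combination hmul + hsq
  rw [hw0] at key
  calc _ ≤ 1 / w r ^ 2 * ((n + q) / n * (w r * w' r) - w r ^ 2 * f' r / n) + f' r / n := by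
        gcongr
        simpa using key
    _ = _ := by
        field_simp
        ring
end

section
/- Let m ≥ 2 be an integer and r > 0. Let w : [0,r] → ℝ be of class C² with w(0) = 0 and w(t) > 0 for all t ∈ (0,r]; let f : [0,r] → ℝ be of class C²; let θ : [0,r] → ℝ be of class C¹ and non-decreasing; and let S : [0,r] → ℝ be continuous. Assume: (i) S(t) − f''(t)/(m−1) ≥ −w''(t)/w(t) for all t ∈ (0,r], and (ii) f'(t)·w'(t) ≤ θ(t)·w'(t) for all t ∈ [0,r]. Then (1/w(r)²)·∫_0^r (w'(t)² − S(t)·w(t)²) dt + f'(r)/(m−1) ≤ w'(r)/w(r) + θ(r)/(m−1). -/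
/-- Analytic core of the Hessian comparison under a lower bound on the `∞`-weighted
sectional curvature (Theorem 3.2(b) of Hurtado–Palmer–Rosales): if
`S(t) - f''(t)/(m-1) ≥ -w''(t)/w(t)` on `(0,r]` and `f'(t) w'(t) ≤ θ(t) w'(t)` on `[0,r]`
with `θ` C¹ and non-decreasing, then
`(1/w(r)²) ∫_0^r (w'(t)² - S(t) w(t)²) dt + f'(r)/(m-1) ≤ w'(r)/w(r) + θ(r)/(m-1)`. -/
theorem stmt_8 (m : ℕ) (hm : 2 ≤ m) (r : ℝ) (hr : 0 < r)
    (w w' w'' f f' f'' θ θ' S : ℝ → ℝ)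
    (hw' : ∀ t ∈ Set.Icc 0 r, HasDerivWithinAt w (w' t) (Set.Icc 0 r) t)
    (hw'' : ∀ t ∈ Set.Icc 0 r, HasDerivWithinAt w' (w'' t) (Set.Icc 0 r) t)
    (hw''c : ContinuousOn w'' (Set.Icc 0 r))
    (hw0 : w 0 = 0) (hwpos : ∀ t ∈ Set.Ioc 0 r, 0 < w t)
    (hf' : ∀ t ∈ Set.Icc 0 r, HasDerivWithinAt f (f' t) (Set.Icc 0 r) t)
    (hf'' : ∀ t ∈ Set.Icc 0 r, HasDerivWithinAt f' (f'' t) (Set.Icc 0 r) t)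
    (hf''c : ContinuousOn f'' (Set.Icc 0 r))
    (hθ' : ∀ t ∈ Set.Icc 0 r, HasDerivWithinAt θ (θ' t) (Set.Icc 0 r) t)
    (hθ'c : ContinuousOn θ' (Set.Icc 0 r))
    (hθmono : MonotoneOn θ (Set.Icc 0 r))
    (hS : ContinuousOn S (Set.Icc 0 r))
    (hi : ∀ t ∈ Set.Ioc 0 r, S t - f'' t / ((m : ℝ) - 1) ≥ -w'' t / w t)
    (hii : ∀ t ∈ Set.Icc 0 r, f' t * w' t ≤ θ t * w' t) :
    (1 / (w r) ^ 2) * (∫ t in (0 : ℝ)..r, ((w' t) ^ 2 - S t * (w t) ^ 2)) +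
      f' r / ((m : ℝ) - 1) ≤ w' r / w r + θ r / ((m : ℝ) - 1) := by
  have hm_pos : (0 : ℝ) < (m : ℝ) - 1 := by
    have : (2 : ℝ) ≤ m := by exact_mod_cast hm
    linarith
  obtain ⟨c, hc⟩ : ∃ c : ℝ, c = ((m : ℝ) - 1)⁻¹ := ⟨_, rfl⟩
  have hc_pos : 0 < c := hc ▸ inv_pos.2 hm_pos
  simp only [div_eq_mul_inv _ ((m : ℝ) - 1), ← hc] at hi ⊢
  have hθ'_nonneg : ∀ t ∈ Set.Icc 0 r, 0 ≤ θ' t := fun t ht => by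
    rw [← (hθ' t ht).derivWithin (uniqueDiffOn_Icc hr t ht)]
    exact hθmono.derivWithin_nonneg
  have hG : ∀ t ∈ Set.Icc 0 r, HasDerivWithinAt
      (fun t => w t * w' t + c * ((θ t - f' t) * w t ^ 2))
      (w' t * w' t + w t * w'' t +
        c * ((θ' t - f'' t) * w t ^ 2 + (θ t - f' t) * (2 * w t * w' t)))
      (Set.Icc 0 r) t := fun t ht => by
    have h := ((hw' t ht).mul (hw'' t ht)).add
      ((((hθ' t ht).sub (hf'' t ht)).mul ((hw' t ht).pow 2)).const_mul c)
    refine h.congr_deriv ?_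
    simp
  have hint : (∫ t in (0 : ℝ)..r, ((w' t) ^ 2 - S t * (w t) ^ 2)) ≤
      w r * w' r + c * ((θ r - f' r) * w r ^ 2) := by
    have h := intervalIntegral.integral_le_sub_of_hasDeriv_right_of_le
      (φ := fun t => (w' t) ^ 2 - S t * (w t) ^ 2) hr.le
      (fun t ht => (hG t ht).continuousWithinAt)
      (fun t ht => ((hG t (Set.Ioo_subset_Icc_self ht)).hasDerivAt
        (Icc_mem_nhds ht.1 ht.2)).hasDerivWithinAt)
      (ContinuousOn.integrableOn_Icc
        (((show ContinuousOn w' (Set.Icc 0 r) from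
            fun t ht => (hw'' t ht).continuousWithinAt).pow 2).sub
          (hS.mul ((show ContinuousOn w (Set.Icc 0 r) from
            fun t ht => (hw' t ht).continuousWithinAt).pow 2))))
      (fun t ht => by
        have htc := Set.Ioo_subset_Icc_self ht
        have hwt : 0 < w t := hwpos t (Set.Ioo_subset_Ioc_self ht)
        have hcurv : -w'' t * w t ≤ (S t - f'' t * c) * w t ^ 2 := by
          have h := (div_le_iff₀ hwt).1 (hi t (Set.Ioo_subset_Ioc_self ht))
          nlinarith [mul_le_mul_of_nonneg_right h hwt.le]
        have hdrift : 0 ≤ c * (w t * (θ t * w' t - f' t * w' t)) :=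
          mul_nonneg hc_pos.le (mul_nonneg hwt.le (sub_nonneg.2 (hii t htc)))
        have hmono : 0 ≤ c * (θ' t * w t ^ 2) :=
          mul_nonneg hc_pos.le (mul_nonneg (hθ'_nonneg t htc) (sq_nonneg _))
        linarith)
    simpa [hw0] using h
  have hwr : 0 < w r := hwpos r ⟨hr, le_rfl⟩
  calc _ ≤ 1 / w r ^ 2 * (w r * w' r + c * ((θ r - f' r) * w r ^ 2)) + f' r * c := by gcongr
    _ = w' r / w r + θ r * c := by
      field_simp
      ring
end

section
/- Let r > 0. Let w : [0,r] → ℝ be of class C¹ with w(0) = 0 and w(t) ≥ 0 for all t ∈ [0,r]; let f : [0,r] → ℝ be of class C¹; and let θ : [0,r] → ℝ be of class C¹ and non-decreasing, with f'(t)·w'(t) ≤ θ(t)·w'(t) for all t ∈ [0,r]. Then ∫_0^r 2·w(t)·w'(t)·f'(t) dt ≤ θ(r)·w(r)². -/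
/-- Integration-by-parts inequality (key step in Theorems 3.1(b) and 3.2(b) of
Hurtado–Palmer–Rosales): if `w` is C¹ on `[0,r]` with `w(0) = 0` and `w ≥ 0`, `f` is C¹,
`θ` is C¹ and non-decreasing, and `f'(t) w'(t) ≤ θ(t) w'(t)` on `[0,r]`, then
`∫_0^r 2 w(t) w'(t) f'(t) dt ≤ θ(r) w(r)²`. -/
theorem stmt_9 (r : ℝ) (hr : 0 < r)
    (w w' f f' θ θ' : ℝ → ℝ)
    (hw' : ∀ t ∈ Set.Icc 0 r, HasDerivWithinAt w (w' t) (Set.Icc 0 r) t)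
    (hw'c : ContinuousOn w' (Set.Icc 0 r))
    (hw0 : w 0 = 0) (hwnn : ∀ t ∈ Set.Icc 0 r, 0 ≤ w t)
    (hf' : ∀ t ∈ Set.Icc 0 r, HasDerivWithinAt f (f' t) (Set.Icc 0 r) t)
    (hf'c : ContinuousOn f' (Set.Icc 0 r))
    (hθ' : ∀ t ∈ Set.Icc 0 r, HasDerivWithinAt θ (θ' t) (Set.Icc 0 r) t)
    (hθ'c : ContinuousOn θ' (Set.Icc 0 r))
    (hθmono : MonotoneOn θ (Set.Icc 0 r))
    (hii : ∀ t ∈ Set.Icc 0 r, f' t * w' t ≤ θ t * w' t) :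
    (∫ t in (0 : ℝ)..r, 2 * w t * w' t * f' t) ≤ θ r * (w r) ^ 2 := by
  have hθ'nn : ∀ t ∈ Set.Icc 0 r, 0 ≤ θ' t := fun t ht => by
    rw [← (hθ' t ht).derivWithin (uniqueDiffOn_Icc hr t ht)]
    exact hθmono.derivWithin_nonneg
  have hwc : ContinuousOn w (Set.Icc 0 r) := fun t ht => (hw' t ht).continuousWithinAt
  have hg : ∀ t ∈ Set.Icc 0 r, HasDerivWithinAt (fun t => θ t * w t ^ 2)
      (θ' t * w t ^ 2 + θ t * (2 * w t * w' t)) (Set.Icc 0 r) t := fun t ht => by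
    exact ((hθ' t ht).mul ((hw' t ht).pow 2)).congr_deriv (by simp)
  have key : (∫ t in (0 : ℝ)..r, 2 * w t * w' t * f' t) ≤ θ r * w r ^ 2 - θ 0 * w 0 ^ 2 := by
    refine intervalIntegral.integral_le_sub_of_hasDeriv_right_of_le
      (g := fun t => θ t * w t ^ 2) hr.le
      (fun t ht => (hg t ht).continuousWithinAt)
      (fun t ht => ((hg t (Set.Ioo_subset_Icc_self ht)).hasDerivAt
        (Icc_mem_nhds ht.1 ht.2)).hasDerivWithinAt)
      (((continuousOn_const.mul hwc).mul hw'c).mul hf'c).integrableOn_Icc fun t ht => ?_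
    have htI := Set.Ioo_subset_Icc_self ht
    have h₁ := mul_le_mul_of_nonneg_left (hii t htI) (hwnn t htI)
    have h₂ := mul_nonneg (hθ'nn t htI) (sq_nonneg (w t))
    linarith
  simpa [hw0] using key
end
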